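/- arXiv:2406.13824 — 9 statements merged into one kernel-verified Lean document; each statement's English description precedes it below -/
import Mathlib

section
/- Fix n agents, m items, and an agent i. Let σ_i be a ranking for agent i, and for ℓ ∈ [n] define the bundle B_ℓ = {σ_i(ℓ + n(t−1)) : t ∈ [⌈m/n⌉], ℓ + n(t−1) ≤ m} (agent i's round-robin allocation). Then (B_1,…,B_n) is a partition of the item set, and agent i is EF1-satisfied with any bundle in it: for all k, ℓ ∈ [n], v_i(B_k) ≥ v_i(B_ℓ) − v̄_i(B_ℓ). -/
/-- Additive value of agent `i` for bundle `A`. -/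
def bundleVal {n m : ℕ} (v : Fin n → Fin m → ℝ) (i : Fin n) (A : Finset (Fin m)) : ℝ :=
  ∑ j ∈ A, v i j

/-- Value of agent `i`'s favorite item in `A` (0 if `A` is empty). -/
def maxVal {n m : ℕ} (v : Fin n → Fin m → ℝ) (i : Fin n) (A : Finset (Fin m)) : ℝ :=
  if h : A.Nonempty then A.sup' h (v i) else 0

/-- Value of agent `i`'s least-valued item in `A` (0 if `A` is empty). -/
def minVal {n m : ℕ} (v : Fin n → Fin m → ℝ) (i : Fin n) (A : Finset (Fin m)) : ℝ :=
  if h : A.Nonempty then A.inf' h (v i) else 0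

/-- `(A 1, …, A n)` is a partition of the items: every item is in exactly one bundle. -/
def IsPartition {n m : ℕ} (A : Fin n → Finset (Fin m)) : Prop :=
  ∀ j : Fin m, ∃! k : Fin n, j ∈ A k

/-- Symmetrically envy free up to one good. -/
def SymEF1 {n m : ℕ} (v : Fin n → Fin m → ℝ) (A : Fin n → Finset (Fin m)) : Prop :=
  ∀ i k l : Fin n, bundleVal v i (A k) ≥ bundleVal v i (A l) - maxVal v i (A l)

/-- Symmetrically envy free up to any good. -/
def SymEFX {n m : ℕ} (v : Fin n → Fin m → ℝ) (A : Fin n → Finset (Fin m)) : Prop :=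
  ∀ i k l : Fin n, bundleVal v i (A k) ≥ bundleVal v i (A l) - minVal v i (A l)

/-- `σ` is a ranking for agent `i`: `σ` lists the items from most to least favorite. -/
def IsRanking {n m : ℕ} (v : Fin n → Fin m → ℝ) (i : Fin n) (σ : Equiv.Perm (Fin m)) : Prop :=
  ∀ (j : ℕ) (h : j + 1 < m), v i (σ ⟨j + 1, h⟩) ≤ v i (σ ⟨j, Nat.lt_of_succ_lt h⟩)

/-- The `t`-th indexed `n`-tuple (0-indexed `t`) for the ranking `σ`:
    the items ranked in positions `n*t, …, n*t + n - 1` (0-indexed, positions `< m`). -/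
def nTuple {m : ℕ} (n : ℕ) (σ : Equiv.Perm (Fin m)) (t : ℕ) : Finset (Fin m) :=
  (Finset.univ.filter (fun p : Fin m => p.val / n = t)).image σ

/-- The `l`-th bundle (0-indexed `l`) of the round-robin allocation of the agent whose
    ranking is `σ`: the items ranked in positions congruent to `l` modulo `n`. -/
def rrBundle {m : ℕ} (n : ℕ) (σ : Equiv.Perm (Fin m)) (l : ℕ) : Finset (Fin m) :=
  (Finset.univ.filter (fun p : Fin m => p.val % n = l)).image σ

/-- The partition `A` separates the indexed `n`-tuples induced by the ranking `σ`:
    no two distinct items of a common `n`-tuple lie in the same bundle. -/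
def Separates {n m : ℕ} (σ : Equiv.Perm (Fin m)) (A : Fin n → Finset (Fin m)) : Prop :=
  ∀ (t : ℕ), ∀ j1 ∈ nTuple n σ t, ∀ j2 ∈ nTuple n σ t, j1 ≠ j2 →
    ∀ k : Fin n, j1 ∈ A k → j2 ∉ A k

/-- The item graph: vertices are the items, with an edge between two distinct items
    whenever they belong to a common indexed `n`-tuple of some agent. -/
def itemGraph {m : ℕ} (n : ℕ) (σ : Fin n → Equiv.Perm (Fin m)) : SimpleGraph (Fin m) :=
  SimpleGraph.fromRel (fun j1 j2 => ∃ (i : Fin n) (t : ℕ),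
    j1 ∈ nTuple n (σ i) t ∧ j2 ∈ nTuple n (σ i) t)

theorem IsRanking.antitone {n m : ℕ} {v : Fin n → Fin m → ℝ} {i : Fin n}
    {σ : Equiv.Perm (Fin m)} (hσ : IsRanking v i σ) : Antitone fun p => v i (σ p) := by
  have key : ∀ b (hb : b < m) a (hab : a ≤ b), v i (σ ⟨b, hb⟩) ≤ v i (σ ⟨a, hab.trans_lt hb⟩) := by
    intro b
    induction b with
    | zero =>
      intro hb a hab
      obtain rfl : a = 0 := by omega
      exact le_rfl
    | succ b ih =>
      intro hb a hab
      rcases hab.lt_or_eq with h | rfl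
      · exact (hσ b hb).trans (ih (by omega) a (by omega))
      · exact le_rfl
  exact fun a b hab => key b.1 b.2 a.1 hab

theorem mem_rrBundle {n m : ℕ} {σ : Equiv.Perm (Fin m)} {l : ℕ} {j : Fin m} :
    j ∈ rrBundle n σ l ↔ (σ.symm j).val % n = l := by
  simp only [rrBundle, Finset.mem_image, Finset.mem_filter, Finset.mem_univ, true_and]
  constructor
  · rintro ⟨p, hp, rfl⟩
    simpa using hp
  · exact fun h => ⟨σ.symm j, h, by simp⟩

theorem isPartition_rrBundle {n m : ℕ} (hn : 0 < n) (σ : Equiv.Perm (Fin m)) :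
    IsPartition (fun k : Fin n => rrBundle n σ k.val) := by
  intro j
  refine ⟨⟨(σ.symm j).val % n, Nat.mod_lt _ hn⟩, mem_rrBundle.2 rfl, fun k hk => ?_⟩
  exact Fin.ext (mem_rrBundle.1 hk).symm

theorem bundleVal_rrBundle {n m : ℕ} (v : Fin n → Fin m → ℝ) (i : Fin n)
    (σ : Equiv.Perm (Fin m)) (l : ℕ) :
    bundleVal v i (rrBundle n σ l) =
      ∑ p ∈ Finset.univ.filter (fun p : Fin m => p.val % n = l), v i (σ p) := by
  rw [bundleVal, rrBundle, Finset.sum_image σ.injective.injOn]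

theorem le_maxVal {n m : ℕ} (v : Fin n → Fin m → ℝ) (i : Fin n) {A : Finset (Fin m)} {j : Fin m}
    (hj : j ∈ A) : v i j ≤ maxVal v i A := by
  rw [maxVal, dif_pos ⟨j, hj⟩]
  exact Finset.le_sup' (v i) hj

theorem maxVal_nonneg {n m : ℕ} {v : Fin n → Fin m → ℝ} {i : Fin n} (hv : ∀ j, 0 ≤ v i j)
    (A : Finset (Fin m)) : 0 ≤ maxVal v i A := by
  rcases A.eq_empty_or_nonempty with rfl | ⟨j, hj⟩
  · simp [maxVal]
  · exact (hv j).trans (le_maxVal v i hj)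

/-- In a nonincreasing sequence of nonnegative reals, the terms at positions `≡ l [MOD n]`
beyond the first `n` sum to at most the terms at positions `≡ k [MOD n]`. -/
theorem sum_mod_eq_and_le_le_sum_mod_eq {n m : ℕ} {w : Fin m → ℝ} (hw : Antitone w)
    (hw0 : ∀ p, 0 ≤ w p) {k l : ℕ} (hk : k < n) :
    ∑ p ∈ Finset.univ.filter (fun p : Fin m => p.val % n = l ∧ n ≤ p.val), w p ≤
      ∑ p ∈ Finset.univ.filter (fun p : Fin m => p.val % n = k), w p := by
  have hle : ∀ p : Fin m, n ≤ p.val → n * (p.val / n - 1) + k ≤ p.val := by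
    intro p hp
    have h1 : 1 ≤ p.val / n := (Nat.one_le_div_iff (by omega)).2 hp
    have h2 := Nat.mul_div_le p.val n
    rw [Nat.mul_sub, mul_one]
    have h3 : n * 1 ≤ n * (p.val / n) := Nat.mul_le_mul_left n h1
    omega
  let f : Fin m → Fin m := fun p =>
    if hp : n ≤ p.val then ⟨n * (p.val / n - 1) + k, (hle p hp).trans_lt p.2⟩ else p
  have hf : ∀ p : Fin m, n ≤ p.val → (f p).val = n * (p.val / n - 1) + k := fun p hp => by
    simp [f, hp]
  have hinj : Set.InjOn f (Finset.univ.filter fun p : Fin m => p.val % n = l ∧ n ≤ p.val) := by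
    intro p hp q hq hpq
    simp only [Finset.coe_filter, Finset.mem_univ, true_and, Set.mem_ofPred_eq] at hp hq
    have h := congrArg Fin.val hpq
    rw [hf p hp.2, hf q hq.2] at h
    have h' := Nat.eq_of_mul_eq_mul_left (by omega) (Nat.add_right_cancel h)
    have hp1 : 1 ≤ p.val / n := (Nat.one_le_div_iff (by omega)).2 hp.2
    have hq1 : 1 ≤ q.val / n := (Nat.one_le_div_iff (by omega)).2 hq.2
    have hdiv : p.val / n = q.val / n := by omega
    apply Fin.ext
    rw [← Nat.div_add_mod p.val n, ← Nat.div_add_mod q.val n, hdiv, hp.1, hq.1]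
  calc _ ≤ ∑ p ∈ Finset.univ.filter (fun p : Fin m => p.val % n = l ∧ n ≤ p.val), w (f p) := by
        refine Finset.sum_le_sum fun p hp => hw ?_
        have hp' := (Finset.mem_filter.1 hp).2.2
        rw [Fin.le_def, hf p hp']
        exact hle p hp'
    _ = ∑ p ∈ (Finset.univ.filter fun p : Fin m => p.val % n = l ∧ n ≤ p.val).image f, w p :=
        (Finset.sum_image hinj).symm
    _ ≤ _ := by
        refine Finset.sum_le_sum_of_subset_of_nonneg ?_ fun p _ _ => hw0 p
        intro q hq
        obtain ⟨p, hp, rfl⟩ := Finset.mem_image.1 hq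
        rw [Finset.mem_filter, hf p (Finset.mem_filter.1 hp).2.2, Nat.mul_add_mod,
          Nat.mod_eq_of_lt hk]
        exact ⟨Finset.mem_univ _, rfl⟩

theorem sum_mod_eq_and_lt_le_maxVal {n m : ℕ} {v : Fin n → Fin m → ℝ} {i : Fin n}
    (hv : ∀ j, 0 ≤ v i j) (σ : Equiv.Perm (Fin m)) (l : ℕ) :
    ∑ p ∈ Finset.univ.filter (fun p : Fin m => p.val % n = l ∧ ¬ n ≤ p.val), v i (σ p) ≤
      maxVal v i (rrBundle n σ l) := by
  have hval : ∀ p : Fin m, p.val % n = l ∧ ¬ n ≤ p.val → p.val = l := fun p hp => by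
    rw [← hp.1, Nat.mod_eq_of_lt (not_le.1 hp.2)]
  rcases (Finset.univ.filter
    (fun p : Fin m => p.val % n = l ∧ ¬ n ≤ p.val)).eq_empty_or_nonempty with h | ⟨p, hp⟩
  · rw [h, Finset.sum_empty]
    exact maxVal_nonneg hv _
  · have hs : Finset.univ.filter (fun p : Fin m => p.val % n = l ∧ ¬ n ≤ p.val) = {p} :=
      Finset.eq_singleton_iff_unique_mem.2 ⟨hp, fun q hq => Fin.ext <| by
        rw [hval q (Finset.mem_filter.1 hq).2, hval p (Finset.mem_filter.1 hp).2]⟩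
    rw [hs, Finset.sum_singleton]
    exact le_maxVal v i (mem_rrBundle.2 (by simpa using (Finset.mem_filter.1 hp).2.1))

/-- Agent `i`'s round-robin allocation is a partition of the items,
and agent `i` is EF1-satisfied with any bundle in it. -/
theorem statement0 {n m : ℕ} (v : Fin n → Fin m → ℝ)
    (hv : ∀ i j, 0 ≤ v i j ∧ v i j ≤ 1)
    (i : Fin n) (σ : Equiv.Perm (Fin m)) (hσ : IsRanking v i σ) :
    IsPartition (fun k : Fin n => rrBundle n σ k.val) ∧
    ∀ k l : Fin n,
      bundleVal v i (rrBundle n σ k.val) ≥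
        bundleVal v i (rrBundle n σ l.val) - maxVal v i (rrBundle n σ l.val) := by
  have hv0 : ∀ j, 0 ≤ v i j := fun j => (hv i j).1
  refine ⟨isPartition_rrBundle i.pos σ, fun k l => ?_⟩
  have htail := sum_mod_eq_and_le_le_sum_mod_eq (l := l.val) hσ.antitone (fun p => hv0 (σ p)) k.2
  have hhead := sum_mod_eq_and_lt_le_maxVal hv0 σ l.val
  have hsplit := Finset.sum_filter_add_sum_filter_not
    (Finset.univ.filter fun p : Fin m => p.val % n = l.val) (fun p => n ≤ p.val)
    (fun p => v i (σ p))
  rw [Finset.filter_filter, Finset.filter_filter] at hsplit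
  rw [bundleVal_rrBundle, bundleVal_rrBundle]
  linarith
end

section
/- For every n ≥ 3 there is an instance with n agents, m = n + 1 items, and binary valuations that admits no symEF1 partition. Concretely, index the items by {0, 1, …, n} and set v_{i0} = 1 for all agents i ∈ [n], and for j ∈ [n] set v_{ij} = 0 if j = i and v_{ij} = 1 otherwise; then no partition of these n + 1 items into n bundles is symEF1. -/
/-- Summing an agent's bundle values over a partition gives the value of all items. -/
theorem IsPartition.sum_bundleVal {n m : ℕ} {A : Fin n → Finset (Fin m)} (hA : IsPartition A)
    (v : Fin n → Fin m → ℝ) (i : Fin n) : ∑ k, bundleVal v i (A k) = ∑ j, v i j := by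
  choose f hf hf' using hA
  have hAf : ∀ k, A k = Finset.univ.filter (fun j => f j = k) := by
    intro k
    ext j
    simp only [Finset.mem_filter, Finset.mem_univ, true_and]
    exact ⟨fun h => (hf' j k h).symm, fun h => h ▸ hf j⟩
  simp only [bundleVal, hAf]
  exact Finset.sum_fiberwise Finset.univ f (v i)

theorem maxVal_le_of_forall_le {n m : ℕ} {v : Fin n → Fin m → ℝ} {i : Fin n} {c : ℝ}
    (hc : 0 ≤ c) (hv : ∀ j, v i j ≤ c) (A : Finset (Fin m)) : maxVal v i A ≤ c := by
  unfold maxVal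
  split_ifs with h
  · exact Finset.sup'_le h _ fun j _ => hv j
  · exact hc

/-- for every `n ≥ 3` there is a binary-valued instance with `n` agents and
`n + 1` items (item `0` valued `1` by everyone; item `j ∈ [n]` valued `0` by agent `j`
and `1` by everyone else) admitting no symEF1 partition. -/
theorem statement3 (n : ℕ) (hn : 3 ≤ n) :
    ∀ A : Fin n → Finset (Fin (n + 1)), IsPartition A →
      ¬ SymEF1 (fun (i : Fin n) (j : Fin (n + 1)) =>
          if j.val = i.val + 1 then (0 : ℝ) else 1) A := by
  intro A hA hEF
  set v : Fin n → Fin (n + 1) → ℝ := fun i j => if j.val = i.val + 1 then 0 else 1 with hv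
  have hv0 : ∀ i j, 0 ≤ v i j := fun i j => by simp only [hv]; split_ifs <;> norm_num
  have hv1 : ∀ i j, v i j ≤ 1 := fun i j => by simp only [hv]; split_ifs <;> norm_num
  -- Two items share a bundle, and some agent values both of them.
  obtain ⟨a, b, k, hab, ha, hb⟩ : ∃ a b k, a ≠ b ∧ a ∈ A k ∧ b ∈ A k := by
    choose f hf _ using id hA
    obtain ⟨a, b, hab, h⟩ := Fintype.exists_ne_map_eq_of_card_lt f (by simp)
    exact ⟨a, b, f a, hab, hf a, h ▸ hf b⟩
  obtain ⟨i, hia, hib⟩ : ∃ i : Fin n, a ≠ i.succ ∧ b ≠ i.succ := by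
    obtain ⟨e, he⟩ := Finset.exists_mem_notMem_of_card_lt_card
      (s := {0, a, b}) (t := (Finset.univ : Finset (Fin (n + 1))))
      (Finset.card_le_three.trans_lt (by simp; omega))
    simp only [Finset.mem_univ, Finset.mem_insert, Finset.mem_singleton, true_and, not_or] at he
    obtain ⟨i, rfl⟩ := Fin.exists_succ_eq.mpr he.1
    exact ⟨i, Ne.symm he.2.1, Ne.symm he.2.2⟩
  have htwo : 2 ≤ bundleVal v i (A k) := by
    have hva : v i a = 1 := if_neg fun h => hia (Fin.ext h)
    have hvb : v i b = 1 := if_neg fun h => hib (Fin.ext h)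
    calc (2 : ℝ) = ∑ j ∈ {a, b}, v i j := by rw [Finset.sum_pair hab, hva, hvb]; norm_num
      _ ≤ bundleVal v i (A k) := Finset.sum_le_sum_of_subset_of_nonneg
        (by simp [Finset.insert_subset_iff, ha, hb]) fun j _ _ => hv0 i j
  have hone : ∀ l, 1 ≤ bundleVal v i (A l) := fun l => by
    linarith [hEF i l k, maxVal_le_of_forall_le zero_le_one (hv1 i) (A k)]
  have htotal : ∑ j, v i j = n := by
    have h : ∀ j, v i j = 1 - if j = i.succ then 1 else 0 := fun j => by
      simp only [hv, Fin.ext_iff, Fin.val_succ]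
      split_ifs <;> norm_num
    simp [h]
  have hlt : ∑ _l : Fin n, (1 : ℝ) < ∑ l, bundleVal v i (A l) :=
    Finset.sum_lt_sum (fun l _ => hone l) ⟨k, Finset.mem_univ k, by linarith⟩
  rw [hA.sum_bundleVal, htotal] at hlt
  simp at hlt
end

section
/- Suppose n divides m, fix a ranking σ_i for each agent i ∈ [n], and let (A_1,…,A_n) be a partition that separates agent i's indexed n-tuples for every i ∈ [n]. Then for all agents i ∈ [n] and bundles k, ℓ ∈ [n]: v_i(A_k) − min_{j ∈ [m]} v_{ij} ≥ v_i(A_ℓ) − v̄_i(A_ℓ). -/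
/-- When `n` divides `m`, each bundle of a separating partition consists of exactly one item from
each indexed `n`-tuple. -/
theorem Separates.exists_position {n q : ℕ} {σ : Equiv.Perm (Fin (n * q))}
    {A : Fin n → Finset (Fin (n * q))} (hsep : Separates σ A) (hA : IsPartition A) (k : Fin n) :
    ∃ p : Fin q → Fin (n * q), (∀ t, (p t).val / n = t) ∧
      A k = Finset.univ.image fun t => σ (p t) := by
  have hn : 0 < n := k.pos
  have mem_tuple : ∀ p : Fin (n * q), σ p ∈ nTuple n σ (p.val / n) := fun p =>
    Finset.mem_image_of_mem σ (by simp)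
  choose owner howner _ using hA
  have hex : ∀ t : Fin q, ∃ p : Fin (n * q), p.val / n = t ∧ σ p ∈ A k := by
    intro t
    have hlt : ∀ r : Fin n, n * t.val + r.val < n * q := fun r => by
      have := Nat.mul_le_mul_left n (Nat.succ_le_of_lt t.isLt)
      rw [Nat.mul_succ] at this
      omega
    have hdiv : ∀ r : Fin n, (n * t.val + r.val) / n = t := fun r => by
      rw [Nat.mul_add_div hn, Nat.div_eq_of_lt r.isLt, add_zero]
    have hinj : Function.Injective fun r : Fin n => owner (σ ⟨n * t.val + r.val, hlt r⟩) := by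
      intro r r' h
      by_contra hne
      have h1 := mem_tuple ⟨n * t.val + r.val, hlt r⟩
      have h2 := mem_tuple ⟨n * t.val + r'.val, hlt r'⟩
      simp only [hdiv] at h1 h2
      refine hsep t _ h1 _ h2 (fun he => hne ?_) _ (howner _) ?_
      · have := congrArg Fin.val (σ.injective he)
        exact Fin.ext (by simpa using this)
      · dsimp only at h
        rw [h]
        exact howner _
    obtain ⟨r, hr⟩ := Finite.surjective_of_injective hinj k
    exact ⟨⟨n * t.val + r.val, hlt r⟩, hdiv r, hr ▸ howner _⟩
  choose p hp hpA using hex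
  refine ⟨p, hp, Finset.ext fun j => ⟨fun hj => ?_, fun hj => ?_⟩⟩
  · obtain ⟨x, rfl⟩ := σ.surjective j
    have hx : x.val / n < q := Nat.div_lt_of_lt_mul x.isLt
    refine Finset.mem_image.2 ⟨⟨x.val / n, hx⟩, Finset.mem_univ _, ?_⟩
    by_contra hne
    have h1 := mem_tuple (p ⟨x.val / n, hx⟩)
    rw [hp] at h1
    exact hsep _ _ h1 _ (mem_tuple x) hne k (hpA _) hj
  · obtain ⟨t, _, rfl⟩ := Finset.mem_image.1 hj
    exact hpA t

/-- if `n` divides `m` and a partition separates every agent's indexed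
`n`-tuples, then `vᵢ(A k) - min_{j ∈ [m]} v i j ≥ vᵢ(A l) - v̄ᵢ(A l)` for all `i, k, l`. -/
theorem statement4 {n m : ℕ} (hnm : n ∣ m) (v : Fin n → Fin m → ℝ)
    (hv : ∀ i j, 0 ≤ v i j ∧ v i j ≤ 1)
    (σ : Fin n → Equiv.Perm (Fin m)) (hσ : ∀ i, IsRanking v i (σ i))
    (A : Fin n → Finset (Fin m)) (hA : IsPartition A)
    (hsep : ∀ i : Fin n, Separates (σ i) A) :
    ∀ i k l : Fin n,
      bundleVal v i (A k) - minVal v i Finset.univ ≥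
        bundleVal v i (A l) - maxVal v i (A l) := by
  intro i k l
  obtain ⟨q, rfl⟩ := hnm
  obtain ⟨p, hp, hk⟩ := (hsep i).exists_position hA k
  obtain ⟨p', hp', hl⟩ := (hsep i).exists_position hA l
  have anti := (hσ i).antitone
  have sum_eq : ∀ r : Fin q → Fin (n * q), (∀ t, (r t).val / n = t) →
      bundleVal v i (Finset.univ.image fun t => σ i (r t)) = ∑ t, v i (σ i (r t)) := by
    intro r hr
    refine Finset.sum_image fun a _ b _ hab => Fin.ext ?_
    rw [← hr a, ← hr b, (σ i).injective hab]
  rw [hk, sum_eq p hp]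
  have hsum := sum_eq p' hp'
  rw [← hl] at hsum
  rw [hsum]
  cases q with
  | zero =>
    have hempty : A l = ∅ := by simp [hl]
    simp [minVal, maxVal, hempty]
  | succ s =>
    have hmax : v i (σ i (p' 0)) ≤ maxVal v i (A l) := by
      have hmem : σ i (p' 0) ∈ A l := hl ▸ Finset.mem_image_of_mem _ (Finset.mem_univ 0)
      rw [maxVal, dif_pos ⟨_, hmem⟩]
      exact Finset.le_sup' (v i) hmem
    have hmin : minVal v i Finset.univ ≤ v i (σ i (p (Fin.last s))) := by
      have hmem := Finset.mem_univ (σ i (p (Fin.last s)))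
      rw [minVal, dif_pos ⟨_, hmem⟩]
      exact Finset.inf'_le (v i) hmem
    have hstep : ∑ t : Fin s, v i (σ i (p' t.succ)) ≤ ∑ t : Fin s, v i (σ i (p t.castSucc)) := by
      refine Finset.sum_le_sum fun t _ => anti ?_
      by_contra hlt
      have h := Nat.div_le_div_right (c := n) (Fin.val_fin_le.2 (not_le.1 hlt).le)
      rw [hp, hp', Fin.val_succ, Fin.val_castSucc] at h
      omega
    rw [Fin.sum_univ_castSucc, Fin.sum_univ_succ]
    linarith
end

section
/- Fix a ranking σ_i for each agent i ∈ [n]. If a partition (A_1,…,A_n) separates agent i's indexed n-tuples for every i ∈ [n], then (A_1,…,A_n) is a symEF1 partition. -/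
theorem mem_nTuple {m n : ℕ} {σ : Equiv.Perm (Fin m)} {t : ℕ} {j : Fin m} :
    j ∈ nTuple n σ t ↔ (σ.symm j).val / n = t := by
  simp only [nTuple, Finset.mem_image, Finset.mem_filter, Finset.mem_univ, true_and]
  constructor
  · rintro ⟨p, hp, rfl⟩
    simpa using hp
  · intro h
    exact ⟨σ.symm j, h, by simp⟩

theorem IsRanking.le_of_rank_le {n m : ℕ} {v : Fin n → Fin m → ℝ} {i : Fin n}
    {σ : Equiv.Perm (Fin m)} (hσ : IsRanking v i σ) {p q : ℕ} (hpq : p ≤ q) (hq : q < m) :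
    v i (σ ⟨q, hq⟩) ≤ v i (σ ⟨p, hpq.trans_lt hq⟩) := by
  induction q, hpq using Nat.le_induction with
  | base => exact le_rfl
  | succ q _ ih => exact (hσ q hq).trans (ih (Nat.lt_of_succ_lt hq))

theorem Separates.eq_of_mem {n m : ℕ} {σ : Equiv.Perm (Fin m)} {A : Fin n → Finset (Fin m)}
    (hsep : Separates σ A) {k : Fin n} {j₁ j₂ : Fin m} (h₁ : j₁ ∈ A k) (h₂ : j₂ ∈ A k)
    (h : (σ.symm j₁).val / n = (σ.symm j₂).val / n) : j₁ = j₂ := by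
  by_contra hne
  exact hsep _ j₁ (mem_nTuple.2 h) j₂ (mem_nTuple.2 rfl) hne k h₁ h₂

/-- Every bundle of a separating partition meets every full indexed tuple. -/
theorem Separates.exists_mem {n m : ℕ} {σ : Equiv.Perm (Fin m)} {A : Fin n → Finset (Fin m)}
    (hsep : Separates σ A) (hA : IsPartition A) (k : Fin n) {t : ℕ} (ht : n * t + n ≤ m) :
    ∃ j ∈ A k, (σ.symm j).val / n = t := by
  choose b hb _ using hA
  let g : Fin n → Fin m := fun r => σ ⟨n * t + r.val, by have := r.isLt; omega⟩
  have hg : ∀ r, (σ.symm (g r)).val / n = t := fun r => by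
    simp [g, Nat.mul_add_div r.pos, Nat.div_eq_of_lt r.isLt]
  have hinj : Function.Injective (b ∘ g) := by
    intro r s hrs
    have hmem : g r ∈ A (b (g s)) := by
      have := hb (g r)
      rwa [show b (g r) = b (g s) from hrs] at this
    have h := hsep.eq_of_mem hmem (hb (g s)) ((hg r).trans (hg s).symm)
    have h' := congrArg Fin.val (σ.injective h)
    simp only at h'
    exact Fin.ext (by omega)
  obtain ⟨r, hr⟩ := Finite.surjective_of_injective hinj k
  exact ⟨g r, hr ▸ hb (g r), hg r⟩

/-- a partition that separates every agent's indexed `n`-tuples is symEF1. -/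
theorem statement5 {n m : ℕ} (v : Fin n → Fin m → ℝ)
    (hv : ∀ i j, 0 ≤ v i j ∧ v i j ≤ 1)
    (σ : Fin n → Equiv.Perm (Fin m)) (hσ : ∀ i, IsRanking v i (σ i))
    (A : Fin n → Finset (Fin m)) (hA : IsPartition A)
    (hsep : ∀ i : Fin n, Separates (σ i) A) :
    SymEF1 v A := by
  intro i k l
  have hs := hsep i
  have hfirst : ∑ j ∈ A l with ((σ i).symm j).val / n = 0, v i j ≤ maxVal v i (A l) := by
    obtain h | ⟨a, ha⟩ :=
      ((A l).filter fun j => ((σ i).symm j).val / n = 0).eq_empty_or_nonempty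
    · rw [h, Finset.sum_empty]
      exact maxVal_nonneg (fun j => (hv i j).1) _
    · have h : ((A l).filter fun j => ((σ i).symm j).val / n = 0) = {a} := by
        refine Finset.eq_singleton_iff_unique_mem.2 ⟨ha, fun x hx => ?_⟩
        rw [Finset.mem_filter] at ha hx
        exact hs.eq_of_mem hx.1 ha.1 (hx.2.trans ha.2.symm)
      rw [h, Finset.sum_singleton]
      exact le_maxVal v i (Finset.mem_filter.1 ha).1
  have hpred : ∀ j : Fin m, ∃ j' : Fin m, ((σ i).symm j).val / n ≠ 0 →
      j' ∈ A k ∧ ((σ i).symm j').val / n + 1 = ((σ i).symm j).val / n := by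
    intro j
    by_cases hj : ((σ i).symm j).val / n = 0
    · exact ⟨j, fun h => absurd hj h⟩
    · obtain ⟨t, ht⟩ := Nat.exists_eq_succ_of_ne_zero hj
      have hle : n * t + n ≤ m := by
        have h₁ := Nat.mul_div_le ((σ i).symm j).val n
        rw [ht, Nat.mul_succ] at h₁
        exact h₁.trans ((σ i).symm j).isLt.le
      obtain ⟨j', hj', ht'⟩ := hs.exists_mem hA k hle
      exact ⟨j', fun _ => ⟨hj', by rw [ht', ht]⟩⟩
  choose f hf using hpred
  have hrest : ∑ j ∈ A l with ¬ ((σ i).symm j).val / n = 0, v i j ≤ bundleVal v i (A k) := by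
    have hinj : Set.InjOn f ((A l).filter fun j => ¬ ((σ i).symm j).val / n = 0) := by
      intro x hx y hy hxy
      rw [Finset.mem_coe, Finset.mem_filter] at hx hy
      refine hs.eq_of_mem hx.1 hy.1 ?_
      rw [← (hf x hx.2).2, ← (hf y hy.2).2, hxy]
    calc ∑ j ∈ A l with ¬ ((σ i).symm j).val / n = 0, v i j
        ≤ ∑ j ∈ A l with ¬ ((σ i).symm j).val / n = 0, v i (f j) := by
          refine Finset.sum_le_sum fun j hj => ?_
          have h := (hf j (Finset.mem_filter.1 hj).2).2
          have hlt : ((σ i).symm (f j)).val < ((σ i).symm j).val := by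
            by_contra! hle
            have := Nat.div_le_div_right (c := n) hle
            omega
          simpa using (hσ i).le_of_rank_le hlt.le ((σ i).symm j).isLt
      _ = ∑ j ∈ ((A l).filter fun j => ¬ ((σ i).symm j).val / n = 0).image f, v i j :=
          (Finset.sum_image hinj).symm
      _ ≤ bundleVal v i (A k) := by
          refine Finset.sum_le_sum_of_subset_of_nonneg ?_ fun j _ _ => (hv i j).1
          intro x hx
          obtain ⟨j, hj, rfl⟩ := Finset.mem_image.1 hx
          exact (hf j (Finset.mem_filter.1 hj).2).1
  have hsplit : bundleVal v i (A l) = _ :=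
    (Finset.sum_filter_add_sum_filter_not (A l) (fun j => ((σ i).symm j).val / n = 0)
      (v i)).symm
  linarith
end

section
/- For any instance with two agents (n = 2) and any number m of items with valuations v_{ij} ∈ [0,1], a symEF1 partition of the items into two bundles exists. -/
/-- Two fixed-point-free involutions admit a common two-colouring of their 2-cycles. -/
theorem exists_bool_coloring_of_involutions {α : Type*} (f g : Equiv.Perm α)
    (hf : ∀ x, f (f x) = x) (hg : ∀ x, g (g x) = x) (hf' : ∀ x, f x ≠ x) (hg' : ∀ x, g x ≠ x) :
    ∃ c : α → Bool, (∀ x, c (f x) = !c x) ∧ ∀ x, c (g x) = !c x := by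
  have hff : f * f = 1 := Equiv.ext hf
  have hgg : g * g = 1 := Equiv.ext hg
  have hfi : f⁻¹ = f := inv_eq_of_mul_eq_one_right hff
  have hgi : g⁻¹ = g := inv_eq_of_mul_eq_one_right hgg
  have hconj : ∀ k : ℤ, f * (g * f) ^ k = (g * f) ^ (-k) * f := by
    intro k
    have h : (f * (g * f) * f⁻¹) ^ k = f * (g * f) ^ k * f⁻¹ := conj_zpow
    have h' : f * (g * f) * f⁻¹ = (g * f)⁻¹ := by
      rw [mul_inv_rev, hfi, hgi, mul_assoc, mul_assoc, hff, mul_one]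
    rw [h', inv_zpow', eq_mul_inv_iff_mul_eq] at h
    exact h.symm
  have hconj' : ∀ (k : ℤ) x, f (((g * f) ^ k) x) = ((g * f) ^ (-k)) (f x) := fun k x =>
    congrArg (fun p : Equiv.Perm α => p x) (hconj k)
  let s : Setoid α := Equiv.Perm.SameCycle.setoid (g * f)
  let q : α → Quotient s := Quotient.mk s
  have hq : ∀ {x y}, q x = q y ↔ (g * f).SameCycle x y := Quotient.eq
  have hne : ∀ x, q x ≠ q (f x) := by
    intro x hx
    obtain ⟨k, hk⟩ := hq.1 hx
    obtain ⟨j, rfl | rfl⟩ := Int.even_or_odd' k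
    · apply hf' (((g * f) ^ j) x)
      rw [hconj', ← hk, ← Equiv.Perm.mul_apply, ← zpow_add]
      congr 2
      ring
    · apply hg' (f (((g * f) ^ j) x))
      have h1 : g (f (((g * f) ^ j) x)) = ((g * f) ^ (1 + j)) x := by
        rw [zpow_add, zpow_one]; rfl
      rw [h1, hconj', ← hk, ← Equiv.Perm.mul_apply, ← zpow_add]
      congr 2
      ring
  have hqg : ∀ x, q (g x) = q (f x) := fun x => by
    refine (hq.2 ⟨1, ?_⟩).symm
    simp [hf]
  have hqfg : ∀ x, q (f (g x)) = q x := fun x => by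
    refine hq.2 ⟨1, ?_⟩
    simp [hf, hg]
  let _ : LinearOrder (Quotient s) := IsWellOrder.linearOrder WellOrderingRel
  refine ⟨fun x => decide (q x < q (f x)), fun x => ?_, fun x => ?_⟩
  · beta_reduce
    rw [hf, ← decide_not, decide_eq_decide, not_lt]
    exact ⟨le_of_lt, fun h => lt_of_le_of_ne h (hne x).symm⟩
  · beta_reduce
    rw [hqg, hqfg, ← decide_not, decide_eq_decide, not_lt]
    exact ⟨le_of_lt, fun h => lt_of_le_of_ne h (hne x).symm⟩

/-- The signed sum of an antitone sequence whose signs alternate within each pair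
`2 * t, 2 * t + 1` is bounded by the largest positively signed term. -/
theorem Antitone.signed_sum_le {u : ℕ → ℝ} (hu : Antitone u) (d : ℕ → Bool)
    (hd : ∀ t, d (2 * t + 1) = !d (2 * t)) {X : ℝ} (hX : ∀ p, d p = true → u p ≤ X) (N : ℕ) :
    ∑ p ∈ Finset.range (2 * N + 2), (if d p = true then u p else -u p) ≤ X - u (2 * N + 1) := by
  induction N with
  | zero =>
    have h01 : u 1 ≤ u 0 := hu (by omega)
    have h0 := hX 0
    have h1 := hX 1
    have hd0 := hd 0
    simp only [mul_zero, zero_add] at hd0 ⊢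
    rw [Finset.sum_range_succ, Finset.sum_range_one]
    cases h : d 0 <;> rw [h] at hd0 h0 <;> simp [hd0] at h0 h1 ⊢ <;> linarith
  | succ N ih =>
    have h1 : u (2 * N + 2) ≤ u (2 * N + 1) := hu (by omega)
    have h2 : u (2 * N + 3) ≤ u (2 * N + 2) := hu (by omega)
    have hdN := hd (N + 1)
    simp only [mul_add, mul_one] at hdN ⊢
    rw [Finset.sum_range_succ, Finset.sum_range_succ]
    cases h : d (2 * N + 2) <;> rw [h] at hdN <;> simp [hdN] <;> linarith

/-- The involution of `ℕ` exchanging `2 * t` and `2 * t + 1`. -/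
def pairSwap : Equiv.Perm ℕ :=
  Function.Involutive.toPerm (fun p => if p % 2 = 0 then p + 1 else p - 1) (by
    intro p
    grind)

theorem pairSwap_apply (p : ℕ) : pairSwap p = if p % 2 = 0 then p + 1 else p - 1 := rfl

theorem pairSwap_pairSwap (p : ℕ) : pairSwap (pairSwap p) = p := by
  grind [pairSwap_apply]

theorem pairSwap_ne (p : ℕ) : pairSwap p ≠ p := by
  grind [pairSwap_apply]

/-- If the colours alternate within each pair of consecutively ranked items, the signed sum of
the values is at most any nonnegative bound on the values of the positively coloured items. -/
theorem signed_sum_le_of_ranking {m : ℕ} {w : Fin m → ℝ} (hw : ∀ j, 0 ≤ w j)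
    (σ : Equiv.Perm (Fin m)) (hσ : Antitone (w ∘ σ)) (c : Fin m → Bool) (d : ℕ → Bool)
    (hcd : ∀ p : Fin m, d p = c (σ p)) (hd : ∀ t, d (2 * t + 1) = !d (2 * t)) {X : ℝ}
    (hX0 : 0 ≤ X) (hX : ∀ j, c j = true → w j ≤ X) :
    ∑ j, (if c j = true then w j else -w j) ≤ X := by
  let u : ℕ → ℝ := fun p => if h : p < m then w (σ ⟨p, h⟩) else 0
  have hu_nonneg : ∀ p, 0 ≤ u p := by
    intro p
    simp only [u]
    split_ifs
    exacts [hw _, le_rfl]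
  have hu : Antitone u := by
    intro p r hpr
    by_cases hr : r < m
    · simp only [u, dif_pos hr, dif_pos (hpr.trans_lt hr)]
      exact hσ (Fin.mk_le_mk.2 hpr)
    · simpa only [u, dif_neg hr] using hu_nonneg p
  have huX : ∀ p, d p = true → u p ≤ X := by
    intro p hp
    simp only [u]
    split_ifs with h
    · exact hX _ ((hcd ⟨p, h⟩).symm.trans hp)
    · exact hX0
  have hsum : ∑ j, (if c j = true then w j else -w j) =
      ∑ p ∈ Finset.range (2 * m + 2), (if d p = true then u p else -u p) := by
    rw [← Equiv.sum_comp σ, ← Finset.sum_subset (Finset.range_mono (by omega : m ≤ 2 * m + 2)),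
      ← Fin.sum_univ_eq_sum_range]
    · refine Finset.sum_congr rfl fun p _ => ?_
      simp [hcd, u]
    · intro p _ hp
      have : ¬ p < m := by simpa using hp
      simp [u, this]
  rw [hsum]
  linarith [hu.signed_sum_le d hd huX m, hu_nonneg (2 * m + 1)]

/-- for two agents, a symEF1 partition always exists. -/
theorem statement8 {m : ℕ} (v : Fin 2 → Fin m → ℝ)
    (hv : ∀ i j, 0 ≤ v i j ∧ v i j ≤ 1) :
    ∃ A : Fin 2 → Finset (Fin m), IsPartition A ∧ SymEF1 v A := by
  let σ : Fin 2 → Equiv.Perm (Fin m) := fun i => Tuple.sort fun j => -v i j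
  have hσ : ∀ i, Antitone (v i ∘ σ i) := fun i a b hab =>
    neg_le_neg_iff.1 (Tuple.monotone_sort (fun j => -v i j) hab)
  let e : Fin 2 → Equiv.Perm ℕ := fun i => (σ i).extendDomain Fin.equivSubtype
  have he : ∀ i (p : Fin m), e i p = σ i p := fun i p =>
    (σ i).extendDomain_apply_image Fin.equivSubtype p
  let f : Fin 2 → Equiv.Perm ℕ := fun i => e i * pairSwap * (e i)⁻¹
  have hf : ∀ i x, f i (f i x) = x := by
    intro i x
    simp [f, pairSwap_pairSwap]
  have hf' : ∀ i x, f i x ≠ x := by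
    intro i x h
    apply pairSwap_ne ((e i)⁻¹ x)
    rw [Equiv.Perm.eq_inv_iff_eq]
    exact h
  obtain ⟨c, hc0, hc1⟩ :=
    exists_bool_coloring_of_involutions (f 0) (f 1) (hf 0) (hf 1) (hf' 0) (hf' 1)
  have hc : ∀ i x, c (f i x) = !c x := Fin.forall_fin_two.2 ⟨hc0, hc1⟩
  have hce : ∀ i t, c (e i (2 * t + 1)) = !c (e i (2 * t)) := by
    intro i t
    rw [← hc i]
    simp [f, pairSwap_apply]
  let A : Fin 2 → Finset (Fin m) := fun k => Finset.univ.filter fun j => c j = decide (k = 0)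
  have hA : ∀ k j, j ∈ A k ↔ c j = decide (k = 0) := by simp [A]
  refine ⟨A, ?_, ?_⟩
  · intro j
    cases h : c j
    · refine ⟨1, by simp [hA, h], fun k hk => ?_⟩
      simp only [hA, h] at hk
      fin_cases k <;> simp at hk ⊢
    · refine ⟨0, by simp [hA, h], fun k hk => ?_⟩
      simp only [hA, h] at hk
      fin_cases k <;> simp at hk ⊢
  · intro i k l
    have hM : 0 ≤ maxVal v i (A l) := maxVal_nonneg (fun j => (hv i j).1) _
    by_cases hkl : k = l
    · subst hkl
      linarith
    have hkey := signed_sum_le_of_ranking (fun j => (hv i j).1) (σ i) (hσ i)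
      (fun j => c j == decide (l = 0)) (fun p => c (e i p) == decide (l = 0))
      (fun p => by simp only [he]) (fun t => by
        rw [hce]
        cases c (e i (2 * t)) <;> cases decide (l = 0) <;> rfl) hM
      (fun j hj => le_maxVal v i ((hA l j).2 (by simpa using hj)))
    have hAk : A k = Finset.univ.filter fun j : Fin m => ¬ (c j == decide (l = 0)) = true := by
      ext j
      rw [hA]
      fin_cases k <;> fin_cases l <;> simp_all
    have hAl : A l = Finset.univ.filter fun j : Fin m => (c j == decide (l = 0)) = true := by
      ext j
      simp [hA]
    rw [Finset.sum_ite, Finset.sum_neg_distrib, ← hAk, ← hAl] at hkey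
    unfold bundleVal
    linarith
end

section
/- Let 0 < ε < 1/2. Consider two agents and three items a, b, c with valuations v_1(a) = 1, v_1(b) = 1/2, v_1(c) = 1/2 + ε and v_2(a) = 1, v_2(b) = 1/2 + ε, v_2(c) = 1/2. Then a partition (A_1, A_2) of {a, b, c} into two bundles is symEF1 if and only if {A_1, A_2} = {{a}, {b, c}}; in particular, the symEF1 partition is unique up to the ordering of the bundles. -/
/-- The valuations of Example "unique symEF1 for n = 2, m = 3":
items `a = 0`, `b = 1`, `c = 2`. -/
noncomputable def exVal13 (ε : ℝ) : Fin 2 → Fin 3 → ℝ :=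
  ![![1, 1 / 2, 1 / 2 + ε], ![1, 1 / 2 + ε, 1 / 2]]

/-- In a partition into two bundles, the second bundle is the complement of the first. -/
theorem IsPartition.eq_compl {m : ℕ} {A : Fin 2 → Finset (Fin m)} (hA : IsPartition A) :
    A 1 = (A 0)ᶜ := by
  ext j
  obtain ⟨k, hk, hu⟩ := hA j
  rw [Finset.mem_compl]
  refine ⟨fun h1 h0 => zero_ne_one ((hu 0 h0).trans (hu 1 h1).symm), fun h0 => ?_⟩
  fin_cases k
  · exact absurd hk h0
  · exact hk

/-- `maxVal` is at most any nonnegative upper bound of the item values. -/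
theorem maxVal_le {n m : ℕ} (v : Fin n → Fin m → ℝ) (i : Fin n) {A : Finset (Fin m)} {c : ℝ}
    (hc : 0 ≤ c) (h : ∀ j ∈ A, v i j ≤ c) : maxVal v i A ≤ c := by
  unfold maxVal
  split_ifs with hn
  · exact Finset.sup'_le hn (v i) h
  · exact hc

theorem exVal13_le_one {ε : ℝ} (hε : ε < 1 / 2) (i : Fin 2) (j : Fin 3) : exVal13 ε i j ≤ 1 := by
  fin_cases i <;> fin_cases j <;> simp [exVal13] <;> linarith

/-- The partition `{a}, {b, c}` is symEF1, in either order of the bundles. -/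
theorem symEF1_exVal13 {ε : ℝ} (hε0 : 0 < ε) (hε : ε < 1 / 2) {A : Fin 2 → Finset (Fin 3)}
    (h : (A 0 = {0} ∧ A 1 = {1, 2}) ∨ (A 0 = {1, 2} ∧ A 1 = {0})) :
    SymEF1 (exVal13 ε) A := by
  have single (i : Fin 2) : (1 : ℝ) ≤ maxVal (exVal13 ε) i {0} := by
    refine le_trans ?_ (le_maxVal _ i (Finset.mem_singleton_self 0))
    fin_cases i <;> simp [exVal13]
  have pair (i : Fin 2) : 1 / 2 + ε ≤ maxVal (exVal13 ε) i {1, 2} := by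
    fin_cases i
    · exact le_maxVal (exVal13 ε) 0 (j := 2) (by decide)
    · exact le_maxVal (exVal13 ε) 1 (j := 1) (by decide)
  have single_sum (i : Fin 2) : bundleVal (exVal13 ε) i {0} = 1 := by
    fin_cases i <;> simp [bundleVal, exVal13]
  have pair_sum (i : Fin 2) : bundleVal (exVal13 ε) i {1, 2} = 1 + ε := by
    fin_cases i <;> simp [bundleVal, exVal13] <;> ring
  intro i k l
  have hs := single i
  have hp := pair i
  rcases h with ⟨h0, h1⟩ | ⟨h0, h1⟩ <;> fin_cases k <;> fin_cases l <;>
    simp only [Fin.zero_eta, Fin.mk_one, h0, h1, single_sum, pair_sum] <;> linarith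

/-- for `0 < ε < 1/2`, a partition of the three items is symEF1 if and only
if its bundles are `{a}` and `{b, c}`; so the symEF1 partition is unique up to ordering. -/
theorem statement13 (ε : ℝ) (hε0 : 0 < ε) (hε : ε < 1 / 2)
    (A : Fin 2 → Finset (Fin 3)) (hA : IsPartition A) :
    SymEF1 (exVal13 ε) A ↔
      (A 0 = {0} ∧ A 1 = {1, 2}) ∨ (A 0 = {1, 2} ∧ A 1 = {0}) := by
  refine ⟨fun h => ?_, symEF1_exVal13 hε0 hε⟩
  have h1 := hA.eq_compl
  have key (i k l : Fin 2) :
      bundleVal (exVal13 ε) i (A l) - 1 ≤ bundleVal (exVal13 ε) i (A k) := by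
    have := h i k l
    have := maxVal_le (exVal13 ε) i (A := A l) zero_le_one fun j _ => exVal13_le_one hε i j
    linarith
  have k1 := key 0 0 1
  have k2 := key 0 1 0
  have k3 := key 1 0 1
  have k4 := key 1 1 0
  rw [h1] at k1 k2 k3 k4 ⊢
  generalize A 0 = B at k1 k2 k3 k4 ⊢
  have cases_B : ∀ B : Finset (Fin 3), B = ∅ ∨ B = {0} ∨ B = {1} ∨ B = {2} ∨ B = {0, 1} ∨
      B = {0, 2} ∨ B = {1, 2} ∨ B = {0, 1, 2} := by decide
  have compl_sum (i : Fin 2) : bundleVal (exVal13 ε) i Bᶜ =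
      2 + ε - bundleVal (exVal13 ε) i B := by
    have hsum : bundleVal (exVal13 ε) i B + bundleVal (exVal13 ε) i Bᶜ = 2 + ε := by
      rw [bundleVal, bundleVal, Finset.sum_add_sum_compl, Fin.sum_univ_three]
      fin_cases i <;> simp [exVal13] <;> ring
    linarith
  rw [compl_sum] at k1 k2 k3 k4
  rcases cases_B B with rfl | rfl | rfl | rfl | rfl | rfl | rfl | rfl
  case inr.inl => exact Or.inl (by decide)
  case inr.inr.inr.inr.inr.inr.inl => exact Or.inr (by decide)
  all_goals
    simp [bundleVal, exVal13] at k1 k2 k3 k4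
    linarith
end

section
/- Let 0 < ε ≤ 1/10. Consider two agents and six items a, b, c, d, e, f with valuations v_1 = (1, 2, 3, 4, 5, 6) and v_2 = (3, 1 + ε, 3, 1, 3, 1 + 2ε). Then: (i) the allocation assigning A_1 = {b, d, f} to agent 1 and A_2 = {a, c, e} to agent 2 maximizes the Nash welfare v_1(A_1)·v_2(A_2) over all allocations (partitions together with assignments of bundles to agents), attaining Nash welfare 108; (ii) the partition ({b, d, f}, {a, c, e}) is not symEF1; and (iii) the partition ({c, d, f}, {a, b, e}) is symEF1. -/
/-- The valuations of the MNW example: items `a = 0, …, f = 5`. -/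
def exVal16 (ε : ℝ) : Fin 2 → Fin 6 → ℝ :=
  ![![1, 2, 3, 4, 5, 6], ![3, 1 + ε, 3, 1, 3, 1 + 2 * ε]]

/-- In a partition among two agents, reassigning the bundles gives complementary bundles. -/
lemma IsPartition.perm_one_eq_compl {m : ℕ} {A : Fin 2 → Finset (Fin m)} (hA : IsPartition A)
    (π : Equiv.Perm (Fin 2)) : A (π 1) = (A (π 0))ᶜ := by
  ext j
  obtain ⟨k, hk, huniq⟩ := hA j
  rw [Finset.mem_compl]
  constructor
  · intro h1 h0
    have := π.injective ((huniq _ h1).trans (huniq _ h0).symm)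
    exact absurd this (by decide)
  · intro h0
    obtain ⟨i, rfl⟩ := π.surjective k
    rcases Fin.exists_fin_two.mp ⟨i, rfl⟩ with h | h
    · exact absurd (h ▸ hk) h0
    · exact h ▸ hk

/-- The Nash welfare in the example never exceeds `108`. -/
lemma nashWelfare_exVal16_le {ε : ℝ} (hε0 : 0 < ε) (hε : ε ≤ 1 / 10) (B : Finset (Fin 6)) :
    bundleVal (exVal16 ε) 0 B * bundleVal (exVal16 ε) 1 Bᶜ ≤ 108 := by
  have key : ∀ (v : Fin 6 → ℝ) (C : Finset (Fin 6)),
      ∑ j ∈ C, v j = ∑ j, if j ∈ C then v j else 0 := by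
    intro v C
    simp
  unfold bundleVal
  rw [key _ B, key _ Bᶜ]
  simp only [Fin.sum_univ_six, Finset.mem_compl]
  by_cases h0 : (0 : Fin 6) ∈ B <;> by_cases h1 : (1 : Fin 6) ∈ B <;>
  by_cases h2 : (2 : Fin 6) ∈ B <;> by_cases h3 : (3 : Fin 6) ∈ B <;>
  by_cases h4 : (4 : Fin 6) ∈ B <;> by_cases h5 : (5 : Fin 6) ∈ B <;>
  simp only [h0, h1, h2, h3, h4, h5, not_true_eq_false, not_false_eq_true, if_true, if_false] <;>
  simp only [exVal16, Matrix.cons_val] <;>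
  linarith

/-- for `0 < ε ≤ 1/10`: (i) assigning `{b, d, f}` to agent 1 and
`{a, c, e}` to agent 2 maximizes Nash welfare over all allocations, attaining value 108;
(ii) the partition `({b, d, f}, {a, c, e})` is not symEF1; (iii) the partition
`({c, d, f}, {a, b, e})` is symEF1. -/
theorem statement16 (ε : ℝ) (hε0 : 0 < ε) (hε : ε ≤ 1 / 10) :
    (bundleVal (exVal16 ε) 0 {1, 3, 5} * bundleVal (exVal16 ε) 1 {0, 2, 4} = 108 ∧
      ∀ A : Fin 2 → Finset (Fin 6), IsPartition A → ∀ π : Equiv.Perm (Fin 2),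
        bundleVal (exVal16 ε) 0 (A (π 0)) * bundleVal (exVal16 ε) 1 (A (π 1)) ≤ 108) ∧
    ¬ SymEF1 (exVal16 ε) ![({1, 3, 5} : Finset (Fin 6)), {0, 2, 4}] ∧
    SymEF1 (exVal16 ε) ![({2, 3, 5} : Finset (Fin 6)), {0, 1, 4}] := by
  refine ⟨⟨?_, ?_⟩, ?_, ?_⟩
  · simp [bundleVal, exVal16]
    norm_num
  · intro A hA π
    rw [hA.perm_one_eq_compl π]
    exact nashWelfare_exVal16_le hε0 hε _
  · intro h
    have h' := h 1 0 1
    simp [bundleVal, maxVal, exVal16] at h'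
    linarith
  · intro i k l
    have h25 : (5 : ℝ) ≤ max 2 5 := le_max_right _ _
    have h346 : (6 : ℝ) ≤ max 3 (max 4 6) := (le_max_right _ _).trans (le_max_right _ _)
    have hε3 : (3 : ℝ) ≤ max (1 + ε) 3 := le_max_right _ _
    have h3ε : (3 : ℝ) ≤ max 3 (max 1 (1 + 2 * ε)) := le_max_left _ _
    fin_cases i <;> fin_cases k <;> fin_cases l <;>
      simp [bundleVal, maxVal, exVal16] <;> linarith
end

section
/- Consider three agents and six items a, b, c, d, e, f with valuations v_1 = (6, 5, 4, 3, 2, 1), v_2 = (6, 5, 3, 4, 2, 1), and v_3 = (6, 5, 3, 2, 4, 1) (so the agents' indexed 3-tuples are T_1 = ({a,b,c},{d,e,f}), T_2 = ({a,b,d},{c,e,f}), T_3 = ({a,b,e},{c,d,f})). Then the item graph G(𝒯) contains a clique on {a, b, c, d, e} and hence admits no proper 3-coloring (nor a proper 4-coloring), yet the partition ({a, f}, {c, e}, {b, d}) is symEF1. Consequently, n-colorability of the item graph is a sufficient but not a necessary condition for the existence of a symEF1 partition. -/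
/-- The valuations of the "not necessary" example: items `a = 0, …, f = 5`. -/
def exVal17 : Fin 3 → Fin 6 → ℝ :=
  ![![6, 5, 4, 3, 2, 1], ![6, 5, 3, 4, 2, 1], ![6, 5, 3, 2, 4, 1]]

/-- A weakly decreasing listing of distinct values is strictly decreasing. -/
theorem IsRanking.strictAnti {n m : ℕ} {v : Fin n → Fin m → ℝ} {i : Fin n}
    {σ : Equiv.Perm (Fin m)} (hv : Function.Injective (v i)) (h : IsRanking v i σ) :
    StrictAnti (fun p => v i (σ p)) := by
  refine Antitone.strictAnti_of_injective ?_ (hv.comp σ.injective)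
  cases m with
  | zero => exact fun a => a.elim0
  | succ m => exact Fin.antitone_iff_succ_le.2 fun p => h p (Nat.succ_lt_succ p.isLt)

/-- An agent who values all items differently has only one ranking. -/
theorem IsRanking.unique {n m : ℕ} {v : Fin n → Fin m → ℝ} {i : Fin n}
    {σ τ : Equiv.Perm (Fin m)} (hv : Function.Injective (v i))
    (hσ : IsRanking v i σ) (hτ : IsRanking v i τ) : σ = τ := by
  have hmono : StrictMono (τ.trans σ.symm) := fun a b hab =>
    (hσ.strictAnti hv).lt_iff_gt.1 (by simpa using hτ.strictAnti hv hab)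
  have hid : ⇑(τ.trans σ.symm) = id :=
    (hmono.range_inj strictMono_id).1 (by simp only [Equiv.range_eq_univ, Set.range_id])
  ext p
  have hp : σ.symm (τ p) = p := congrFun hid p
  rw [Equiv.symm_apply_eq] at hp
  rw [hp]

/-- The rankings of the three agents of the example. -/
def exRanking17 : Fin 3 → Equiv.Perm (Fin 6) :=
  ![1, Equiv.swap 2 3, Equiv.swap 2 4 * Equiv.swap 3 4]

/-- The valuations of the example as natural numbers, where comparisons are decidable. -/
def exNatVal17 : Fin 3 → Fin 6 → ℕ :=
  ![![6, 5, 4, 3, 2, 1], ![6, 5, 3, 4, 2, 1], ![6, 5, 3, 2, 4, 1]]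

theorem exVal17_eq_natCast (i : Fin 3) (j : Fin 6) : exVal17 i j = exNatVal17 i j := by
  fin_cases i <;> fin_cases j <;> simp [exVal17, exNatVal17]

theorem exVal17_injective (i : Fin 3) : Function.Injective (exVal17 i) := by
  have hnat : ∀ i, Function.Injective (exNatVal17 i) := by decide
  intro a b hab
  simp only [exVal17_eq_natCast, Nat.cast_inj] at hab
  exact hnat i hab

theorem isRanking_exRanking17 (i : Fin 3) : IsRanking exVal17 i (exRanking17 i) := by
  have hnat : ∀ i (p : Fin 5), exNatVal17 i (exRanking17 i p.succ) ≤
      exNatVal17 i (exRanking17 i p.castSucc) := by decide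
  intro j h
  simp only [exVal17_eq_natCast, Nat.cast_le]
  exact hnat i ⟨j, Nat.lt_of_succ_lt_succ h⟩

theorem exists_mem_nTuple_exRanking17 :
    ∀ a b : Fin 6, a ≠ 5 → b ≠ 5 → ∃ (i : Fin 3) (t : Fin 2),
      a ∈ nTuple 3 (exRanking17 i) t ∧ b ∈ nTuple 3 (exRanking17 i) t := by
  decide

theorem itemGraph_exRanking17_isClique :
    (itemGraph 3 exRanking17).IsClique ({0, 1, 2, 3, 4} : Set (Fin 6)) := by
  have hne : ∀ a ∈ ({0, 1, 2, 3, 4} : Set (Fin 6)), a ≠ 5 := by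
    rintro a ha rfl
    simp at ha
  intro a ha b hb hab
  obtain ⟨i, t, h⟩ := exists_mem_nTuple_exRanking17 a b (hne a ha) (hne b hb)
  exact (SimpleGraph.fromRel_adj _ _ _).2 ⟨hab, Or.inl ⟨i, t, h⟩⟩

theorem maxVal_pair {n m : ℕ} (v : Fin n → Fin m → ℝ) (i : Fin n) (a b : Fin m) :
    maxVal v i {a, b} = max (v i a) (v i b) := by
  simp [maxVal, Finset.sup'_insert]

theorem bundleVal_pair {n m : ℕ} (v : Fin n → Fin m → ℝ) (i : Fin n) {a b : Fin m}
    (hab : a ≠ b) : bundleVal v i {a, b} = v i a + v i b :=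
  Finset.sum_pair hab

theorem exVal17_symEF1 :
    SymEF1 exVal17 ![({0, 5} : Finset (Fin 6)), {2, 4}, {1, 3}] := by
  intro i k l
  fin_cases k <;> fin_cases l <;> fin_cases i <;>
    simp [bundleVal_pair, maxVal_pair, exVal17] <;> norm_num

/-- for this three-agent six-item instance, the item graph contains a
clique on `{a, b, c, d, e}`, hence admits no proper 3-coloring (nor 4-coloring), yet the
partition `({a, f}, {c, e}, {b, d})` is symEF1: `n`-colorability of the item graph is
sufficient but not necessary for existence of a symEF1 partition. -/
theorem statement17 (σ : Fin 3 → Equiv.Perm (Fin 6))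
    (hσ : ∀ i, IsRanking exVal17 i (σ i)) :
    (itemGraph 3 σ).IsClique ({0, 1, 2, 3, 4} : Set (Fin 6)) ∧
    ¬ (itemGraph 3 σ).Colorable 3 ∧
    ¬ (itemGraph 3 σ).Colorable 4 ∧
    SymEF1 exVal17 ![({0, 5} : Finset (Fin 6)), {2, 4}, {1, 3}] := by
  obtain rfl : σ = exRanking17 := funext fun i =>
    (hσ i).unique (exVal17_injective i) (isRanking_exRanking17 i)
  have hclique := itemGraph_exRanking17_isClique
  have hcol : ¬ (itemGraph 3 exRanking17).Colorable 4 := fun h => by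
    have hfin : (itemGraph 3 exRanking17).IsClique
        (({0, 1, 2, 3, 4} : Finset (Fin 6)) : Set (Fin 6)) := by
      simpa using hclique
    exact absurd (hfin.card_le_of_colorable h) (by decide)
  exact ⟨hclique, fun h => hcol (h.mono (by norm_num)), hcol, exVal17_symEF1⟩
end

section
/- Suppose n divides m and fix an agent i with ranking σ_i. In agent i's round-robin allocation (B_1,…,B_n), where B_ℓ = {σ_i(ℓ + n(t−1)) : t ∈ [m/n]}, the least-valued bundle B_n still satisfies the strengthened inequality v_i(B_n) − min_{j∈[m]} v_{ij} ≥ v_i(B_1) − v̄_i(B_1); that is, agent i's value for B_n minus their least-valued item overall is at least their value for the most-valued bundle B_1 minus their favorite item in B_1. -/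
/-- A position `t` in the bundle `l` of a round-robin allocation is a valid rank. -/
theorem mul_add_lt_mul_of_lt {n q l t : ℕ} (hl : l < n) (ht : t < q) : n * t + l < n * q :=
  calc n * t + l < n * t + n := by omega
    _ = n * (t + 1) := by ring
    _ ≤ n * q := Nat.mul_le_mul_left n ht

theorem mem_rrBundle_s18 {m n : ℕ} (σ : Equiv.Perm (Fin m)) (p : Fin m) :
    σ p ∈ rrBundle n σ (p.val % n) :=
  Finset.mem_image_of_mem σ (by simp)

/-- The value of a round-robin bundle, as a sum over rounds. -/
theorem bundleVal_rrBundle_s18 {n q l : ℕ} (hl : l < n) (v : Fin n → Fin (n * q) → ℝ) (i : Fin n)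
    (σ : Equiv.Perm (Fin (n * q))) :
    bundleVal v i (rrBundle n σ l) =
      ∑ t : Fin q, v i (σ ⟨n * t.val + l, mul_add_lt_mul_of_lt hl t.isLt⟩) := by
  rw [bundleVal, rrBundle, Finset.sum_image σ.injective.injOn]
  symm
  refine Finset.sum_bij (fun t _ => ⟨n * t.val + l, mul_add_lt_mul_of_lt hl t.isLt⟩)
    ?_ ?_ ?_ ?_
  · intro t _
    simp [Nat.mod_eq_of_lt hl]
  · intro s _ t _ h
    have h' : n * s.val = n * t.val := by simpa using h
    exact Fin.ext (Nat.eq_of_mul_eq_mul_left (by omega) h')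
  · intro p hp
    have hp' : p.val % n = l := by simpa using hp
    refine ⟨⟨p.val / n, Nat.div_lt_of_lt_mul p.isLt⟩, Finset.mem_univ _, Fin.ext ?_⟩
    have := Nat.div_add_mod p.val n
    rw [hp'] at this
    exact this
  · intro t _
    rfl

theorem minVal_le {n m : ℕ} (v : Fin n → Fin m → ℝ) (i : Fin n) {A : Finset (Fin m)} {j : Fin m}
    (hj : j ∈ A) : minVal v i A ≤ v i j := by
  rw [minVal, dif_pos ⟨j, hj⟩]
  exact Finset.inf'_le (v i) hj

/-- if `n` divides `m`, then in agent `i`'s round-robin allocation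
`(B 1, …, B n)`, the least-valued bundle `B n` satisfies the strengthened inequality
`vᵢ(B n) - min_{j ∈ [m]} v i j ≥ vᵢ(B 1) - v̄ᵢ(B 1)`. -/
theorem statement18 {n m : ℕ} (hnm : n ∣ m) (v : Fin n → Fin m → ℝ)
    (hv : ∀ i j, 0 ≤ v i j ∧ v i j ≤ 1)
    (i : Fin n) (σ : Equiv.Perm (Fin m)) (hσ : IsRanking v i σ) :
    bundleVal v i (rrBundle n σ (n - 1)) - minVal v i Finset.univ ≥
      bundleVal v i (rrBundle n σ 0) - maxVal v i (rrBundle n σ 0) := by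
  obtain ⟨q, rfl⟩ := hnm
  have hn : 0 < n := i.pos
  rw [bundleVal_rrBundle_s18 (Nat.sub_lt hn one_pos), bundleVal_rrBundle_s18 hn]
  cases q with
  | zero => simp [minVal, maxVal, rrBundle, Finset.univ_eq_empty]
  | succ s =>
    rw [Fin.sum_univ_castSucc, Fin.sum_univ_succ]
    have hmax := le_maxVal v i
      (mem_rrBundle_s18 (n := n) σ ⟨0, Nat.mul_pos hn s.succ_pos⟩)
    have hmin := minVal_le v i (Finset.mem_univ
      (σ ⟨n * (Fin.last s).val + (n - 1),
        mul_add_lt_mul_of_lt (Nat.sub_lt hn one_pos) (Fin.last s).isLt⟩))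
    have hsum : ∑ t : Fin s, v i (σ ⟨n * t.succ.val + 0, mul_add_lt_mul_of_lt hn t.succ.isLt⟩) ≤
        ∑ t : Fin s, v i (σ ⟨n * t.castSucc.val + (n - 1),
          mul_add_lt_mul_of_lt (Nat.sub_lt hn one_pos) t.castSucc.isLt⟩) := by
      refine Finset.sum_le_sum fun t _ => ?_
      have hpos : n * t.castSucc.val + (n - 1) + 1 = n * t.succ.val + 0 := by
        simp only [Fin.val_castSucc, Fin.val_succ, Nat.mul_succ]
        omega
      have hlt := mul_add_lt_mul_of_lt hn t.succ.isLt
      rw [← hpos] at hlt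
      simpa only [hpos] using hσ _ hlt
    simp only [Nat.zero_mod] at hmax
    simp only [Fin.val_zero, Nat.mul_zero, Nat.add_zero] at hsum ⊢
    linarith
end
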